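/- Sum of squares of i.i.d. standard Gaussians is chi-squared: Let k ∈ ℕ with k ≥ 1 and let μ be the k-fold product of the standard Gaussian measure on ℝ (mean 0, variance 1). Then the pushforward of μ under the map x ↦ ∑_{i=1}^k x_i² is the Gamma distribution with shape k/2 and rate 1/2 (the chi-squared distribution with k degrees of freedom). -/

import Mathlib

open MeasureTheory ProbabilityTheory

open Set in
lemma not_integrableOn_Ioi_rpow_mul_exp_neg_mul {s r : ℝ} (hr : r ≤ 0) :
    ¬ IntegrableOn (fun x : ℝ ↦ x ^ s * Real.exp (-(r * x))) (Ioi 0) := by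
  refine fun h ↦ not_integrableOn_Ioi_rpow s (h.mono' (by fun_prop) ?_)
  filter_upwards [ae_restrict_mem measurableSet_Ioi] with x (hx : 0 < x)
  rw [Real.norm_of_nonneg (by positivity)]
  refine le_mul_of_one_le_right (by positivity) (Real.one_le_exp ?_)
  nlinarith

lemma mgf_id_gammaMeasure_eq_setIntegral {a r : ℝ} (ha : 0 < a) (hr : 0 < r) (t : ℝ) :
    mgf id (gammaMeasure a r) t =
      r ^ a / Real.Gamma a * ∫ x in Set.Ioi 0, x ^ (a - 1) * Real.exp (-((r - t) * x)) := by
  have hm : Measurable (gammaPDF a r) := (measurable_gammaPDFReal a r).ennreal_ofReal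
  rw [mgf, gammaMeasure, integral_withDensity_eq_integral_toReal_smul hm
      (ae_of_all _ fun _ ↦ ENNReal.ofReal_lt_top),
    ← integral_const_mul, ← integral_Ici_eq_integral_Ioi, ← integral_indicator measurableSet_Ici]
  congr with x
  rw [gammaPDF, ENNReal.toReal_ofReal (gammaPDFReal_nonneg ha hr x), gammaPDFReal]
  by_cases hx : 0 ≤ x
  · rw [if_pos hx, Set.indicator_of_mem (Set.mem_Ici.2 hx), smul_eq_mul, mul_assoc, mul_assoc,
      ← Real.exp_add, id]
    ring_nf
  · rw [if_neg hx, Set.indicator_of_notMem (by simpa using hx), zero_smul]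

lemma mgf_id_gammaMeasure_of_lt {a r t : ℝ} (ha : 0 < a) (hr : 0 < r) (ht : t < r) :
    mgf id (gammaMeasure a r) t = (r / (r - t)) ^ a := by
  have hrt : 0 < r - t := sub_pos.2 ht
  rw [mgf_id_gammaMeasure_eq_setIntegral ha hr, Real.integral_rpow_mul_exp_neg_mul_Ioi ha hrt,
    Real.div_rpow zero_le_one hrt.le, Real.div_rpow hr.le hrt.le, Real.one_rpow]
  have := (Real.Gamma_pos_of_pos ha).ne'
  field_simp

lemma mgf_id_gammaMeasure_of_le {a r t : ℝ} (ha : 0 < a) (hr : 0 < r) (ht : r ≤ t) :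
    mgf id (gammaMeasure a r) t = 0 := by
  rw [mgf_id_gammaMeasure_eq_setIntegral ha hr,
    integral_undef (not_integrableOn_Ioi_rpow_mul_exp_neg_mul (sub_nonpos.2 ht)), mul_zero]

lemma mgf_sq_gaussianReal (t : ℝ) :
    mgf (fun x ↦ x ^ 2) (gaussianReal 0 1) t = √(1 / 2 / (1 / 2 - t)) := by
  rw [mgf, integral_gaussianReal_eq_integral_smul one_ne_zero]
  calc
    ∫ x, gaussianPDFReal 0 1 x • Real.exp (t * x ^ 2)
      = ∫ x, (√(2 * Real.pi))⁻¹ * Real.exp (-(1 / 2 - t) * x ^ 2) := by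
        congr with x
        rw [gaussianPDFReal, smul_eq_mul, mul_assoc, ← Real.exp_add]
        simp only [NNReal.coe_one]
        ring_nf
    _ = √(1 / 2 / (1 / 2 - t)) := by
        rw [integral_const_mul, integral_gaussian, ← Real.sqrt_inv,
          ← Real.sqrt_mul (by positivity)]
        congr 1
        have := Real.pi_ne_zero
        field_simp

lemma mgf_sum_pi {ι : Type*} [Fintype ι] (ν : Measure ℝ) [SigmaFinite ν] (f : ℝ → ℝ) (t : ℝ) :
    mgf (fun x : ι → ℝ ↦ ∑ i, f (x i)) (Measure.pi fun _ ↦ ν) t =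
      mgf f ν t ^ Fintype.card ι := by
  simp_rw [mgf, Finset.mul_sum, Real.exp_sum]
  exact integral_fintype_prod_eq_pow fun x ↦ Real.exp (t * f x)

/-- Two probability measures on `ℝ` are equal if their moment-generating functions agree and are
finite in a neighborhood of `0`. -/
lemma MeasureTheory.Measure.ext_of_mgf_id_eq {μ ν : Measure ℝ} [IsProbabilityMeasure μ]
    [IsFiniteMeasure ν] (h : mgf id μ = mgf id ν) (h0 : 0 ∈ interior (integrableExpSet id μ)) :
    μ = ν := by
  refine Measure.ext_of_charFun (funext fun t ↦ ?_)
  rw [← complexMGF_id_mul_I, ← complexMGF_id_mul_I]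
  exact eqOn_complexMGF_of_mgf h (by simpa using h0)

/-- Sum of squares of `k ≥ 1` i.i.d. standard Gaussians is chi-squared with `k` degrees of
freedom: the pushforward of the `k`-fold product of the standard Gaussian measure under
`x ↦ ∑ i, x_i²` is the Gamma distribution with shape `k/2` and rate `1/2`. -/
theorem sum_sq_gaussian_chiSquared
    (k : ℕ) (hk : 1 ≤ k) :
    Measure.map (fun x : Fin k → ℝ => ∑ i, (x i) ^ 2)
        (Measure.pi fun _ : Fin k => gaussianReal 0 1) =
      gammaMeasure ((k : ℝ) / 2) (1 / 2) := by
  have ha : (0 : ℝ) < k / 2 := by positivity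
  have hr : (0 : ℝ) < 1 / 2 := by norm_num
  have := isProbabilityMeasure_gammaMeasure ha hr
  have hm : Measurable fun x : Fin k → ℝ ↦ ∑ i, x i ^ 2 := by fun_prop
  refine (Measure.ext_of_mgf_id_eq (funext fun t ↦ ?_) ?_).symm
  · rw [mgf_id_map hm.aemeasurable, mgf_sum_pi _ (fun x ↦ x ^ 2), mgf_sq_gaussianReal,
      Fintype.card_fin]
    rcases lt_or_ge t (1 / 2) with ht | ht
    · rw [mgf_id_gammaMeasure_of_lt ha hr ht, Real.sqrt_eq_rpow, ← Real.rpow_mul_natCast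
        (div_nonneg hr.le (sub_nonneg.2 ht.le))]
      ring_nf
    · rw [mgf_id_gammaMeasure_of_le ha hr ht, Real.sqrt_eq_zero_of_nonpos
        (div_nonpos_of_nonneg_of_nonpos hr.le (sub_nonpos.2 ht)), zero_pow (by lia)]
  · refine mem_interior.2 ⟨Set.Iio (1 / 2), fun t (ht : t < 1 / 2) ↦ ?_, isOpen_Iio, hr⟩
    refine mgf_pos_iff.1 ?_
    rw [mgf_id_gammaMeasure_of_lt ha hr ht]
    exact Real.rpow_pos_of_pos (div_pos hr (sub_pos.2 ht)) _
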